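/- Let d ≥ 2, let Λ and Λ̂ be positive definite diagonal d×d real matrices, let h : S^{d−1} → S^{d−1} be a map of the unit hypersphere to itself, and let c : S^{d−1} → ℝ be a function such that for all z, z̃ ∈ S^{d−1}: (h(z̃) − h(z))ᵀ Λ̂ (h(z̃) − h(z)) = c(z) + (z̃ − z)ᵀ Λ (z̃ − z). Then: (i) c(z) = 0 for all z ∈ S^{d−1}; (ii) there exists an orthogonal d×d matrix H with h(z) = H z for all z ∈ S^{d−1}; (iii) there exists a permutation matrix P with Λ̂ = P Λ Pᵀ; and (iv) the orthogonal matrix Pᵀ H commutes with Λ, so that Pᵀ H is block-diagonal with each orthogonal block acting on the coordinates sharing a common diagonal entry of Λ. -/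

import Mathlib

open Matrix

namespace AnisotropicIdentifiability

variable {n : Type*} [Fintype n]

/-- Polarization of the quadratic form of a symmetric matrix. -/
lemma quadraticForm_sub {M : Matrix n n ℝ} (hM : M.IsSymm) (x y : n → ℝ) :
    (x - y) ⬝ᵥ M *ᵥ (x - y) = x ⬝ᵥ M *ᵥ x + y ⬝ᵥ M *ᵥ y - 2 * (x ⬝ᵥ M *ᵥ y) := by
  have hxy : y ⬝ᵥ M *ᵥ x = x ⬝ᵥ M *ᵥ y := by
    rw [dotProduct_mulVec, ← mulVec_transpose, hM.eq, dotProduct_comm]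
  simp only [mulVec_sub, dotProduct_sub, sub_dotProduct, hxy]
  ring

/-- A map matching two symmetric quadratic forms on differences also matches the bilinear forms. -/
lemma bilinearForm_sub_eq {M N : Matrix n n ℝ} (hM : M.IsSymm) (hN : N.IsSymm)
    {s : Set (n → ℝ)} {h : (n → ℝ) → (n → ℝ)}
    (hiso : ∀ z ∈ s, ∀ w ∈ s, (h w - h z) ⬝ᵥ M *ᵥ (h w - h z) = (w - z) ⬝ᵥ N *ᵥ (w - z))
    {x y z w : n → ℝ} (hx : x ∈ s) (hy : y ∈ s) (hz : z ∈ s) (hw : w ∈ s) :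
    (h x - h y) ⬝ᵥ M *ᵥ (h z - h w) = (x - y) ⬝ᵥ N *ᵥ (z - w) := by
  have three : ∀ z ∈ s, (h x - h y) ⬝ᵥ M *ᵥ (h z - h y) = (x - y) ⬝ᵥ N *ᵥ (z - y) := by
    intro z hz
    have h1 := quadraticForm_sub hM (h x - h y) (h z - h y)
    have h2 := quadraticForm_sub hN (x - y) (z - y)
    rw [sub_sub_sub_cancel_right] at h1 h2
    rw [hiso z hz x hx, hiso y hy x hx, hiso y hy z hz] at h1
    linarith
  rw [← sub_sub_sub_cancel_right (h z) (h w) (h y), ← sub_sub_sub_cancel_right z w y,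
    mulVec_sub M (h z - h y), mulVec_sub N (z - y), dotProduct_sub, dotProduct_sub, three z hz,
    three w hw]

/-- Families with the same multiset of values agree up to a permutation of the indices. -/
lemma exists_perm_of_map_univ_eq {α : Type*} {f g : n → α}
    (hfg : Finset.univ.val.map f = Finset.univ.val.map g) :
    ∃ σ : Equiv.Perm n, ∀ i, g (σ i) = f i := by
  classical
  have hcard (a : α) : Nonempty ({i // f i = a} ≃ {i // g i = a}) := by
    rw [← Fintype.card_eq, Fintype.card_subtype, Fintype.card_subtype]
    have := congrArg (Multiset.count a) hfg
    rw [Multiset.count_map, Multiset.count_map] at this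
    simpa [Finset.card_def, eq_comm] using this
  exact ⟨Equiv.ofFiberEquiv fun a => (hcard a).some, Equiv.ofFiberEquiv_map _⟩

variable [DecidableEq n]

/-- A map of the unit sphere matching two nondegenerate quadratic forms on differences is affine. -/
lemma exists_affine_of_quadraticForm_sub_eq {M N : Matrix n n ℝ} (hM : M.IsSymm) (hN : N.IsSymm)
    (hNu : IsUnit N) [Nonempty n] {h : (n → ℝ) → (n → ℝ)}
    (hiso : ∀ z : n → ℝ, z ⬝ᵥ z = 1 → ∀ w : n → ℝ, w ⬝ᵥ w = 1 →
      (h w - h z) ⬝ᵥ M *ᵥ (h w - h z) = (w - z) ⬝ᵥ N *ᵥ (w - z)) :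
    ∃ (A : Matrix n n ℝ) (b : n → ℝ), Aᵀ * M * A = N ∧
      ∀ z : n → ℝ, z ⬝ᵥ z = 1 → h z = A *ᵥ z + b := by
  have polar {x y z w : n → ℝ} (hx : x ⬝ᵥ x = 1) (hy : y ⬝ᵥ y = 1) (hz : z ⬝ᵥ z = 1)
      (hw : w ⬝ᵥ w = 1) :=
    bilinearForm_sub_eq (s := {z | z ⬝ᵥ z = 1}) hM hN hiso hx hy hz hw
  have unit_single (i : n) : (Pi.single i 1 : n → ℝ) ⬝ᵥ Pi.single i 1 = 1 := by simp
  have unit_neg_single (i : n) : (-Pi.single i 1 : n → ℝ) ⬝ᵥ (-Pi.single i 1) = 1 := by simp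
  have sub_neg_single (i : n) :
      (Pi.single i 1 : n → ℝ) - -Pi.single i 1 = (2 : ℝ) • Pi.single i 1 := by
    rw [two_smul, sub_neg_eq_add]
  let A : Matrix n n ℝ :=
    Matrix.of fun k i => (1 / 2 : ℝ) * (h (Pi.single i 1) k - h (-Pi.single i 1) k)
  have hA (i : n) : A *ᵥ Pi.single i 1 =
      (1 / 2 : ℝ) • (h (Pi.single i 1) - h (-Pi.single i 1)) := by
    rw [mulVec_single_one]
    ext k
    simp [A]
  have entry (i : n) (v : n → ℝ) :
      (Aᵀ *ᵥ v) i = (A *ᵥ Pi.single i 1) ⬝ᵥ v := by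
    rw [mulVec_single_one]
    rfl
  have key (i : n) {z w : n → ℝ} (hz : z ⬝ᵥ z = 1) (hw : w ⬝ᵥ w = 1) :
      (Aᵀ *ᵥ (M *ᵥ (h z - h w))) i = (N *ᵥ (z - w)) i := by
    rw [entry, hA, smul_dotProduct, polar (unit_single i) (unit_neg_single i) hz hw,
      sub_neg_single, smul_dotProduct, single_one_dotProduct]
    simp
  have hAMA : Aᵀ * M * A = N := by
    refine ext_of_mulVec_single fun j => ?_
    ext i
    rw [← mulVec_mulVec, ← mulVec_mulVec, hA, mulVec_smul, mulVec_smul, Pi.smul_apply,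
      key i (unit_single j) (unit_neg_single j), sub_neg_single, mulVec_smul]
    simp
  obtain ⟨i₀⟩ := ‹Nonempty n›
  refine ⟨A, h (Pi.single i₀ 1) - A *ᵥ Pi.single i₀ 1, hAMA, fun z hz => ?_⟩
  have hu : IsUnit (Aᵀ * M) := by
    rw [isUnit_iff_isUnit_det] at hNu ⊢
    rw [← hAMA, det_mul] at hNu
    exact isUnit_of_mul_isUnit_left hNu
  have hdiff : h z - h (Pi.single i₀ 1) = A *ᵥ (z - Pi.single i₀ 1) := by
    apply mulVec_injective_of_isUnit hu
    rw [mulVec_mulVec, hAMA, ← mulVec_mulVec]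
    ext i
    exact key i hz (unit_single i₀)
  rw [mulVec_sub] at hdiff
  rw [← add_sub_assoc, add_comm, add_sub_assoc, ← hdiff, add_sub_cancel]

/-- An invertible affine map preserving the unit sphere is linear and orthogonal. -/
lemma orthogonal_of_affine_maps_sphere {A : Matrix n n ℝ} {b : n → ℝ} (hA : IsUnit A)
    (hsphere : ∀ z : n → ℝ, z ⬝ᵥ z = 1 → (A *ᵥ z + b) ⬝ᵥ (A *ᵥ z + b) = 1) :
    Aᵀ * A = 1 ∧ b = 0 := by
  have hb : b = 0 := by
    apply mulVec_injective_of_isUnit ((isUnit_transpose A).2 hA)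
    ext i
    have h1 := hsphere (Pi.single i 1) (by simp)
    have h2 := hsphere (-Pi.single i 1) (by simp)
    have h3 : (Aᵀ *ᵥ b) i = (A *ᵥ Pi.single i 1) ⬝ᵥ b := by
      rw [mulVec_single_one]
      rfl
    simp only [mulVec_zero, Pi.zero_apply]
    rw [h3]
    simp only [mulVec_neg, add_dotProduct, dotProduct_add, neg_dotProduct, dotProduct_neg,
      dotProduct_comm b] at h1 h2
    linarith
  subst hb
  simp only [add_zero] at hsphere
  refine ⟨?_, rfl⟩
  have entry (i j : n) :
      (Aᵀ * A) i j = (A *ᵥ Pi.single i 1) ⬝ᵥ (A *ᵥ Pi.single j 1) := by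
    rw [mulVec_single_one, mulVec_single_one]
    rfl
  have diag (i : n) : (A *ᵥ Pi.single i 1) ⬝ᵥ (A *ᵥ Pi.single i 1) = 1 :=
    hsphere _ (by simp)
  ext i j
  rw [entry]
  rcases eq_or_ne i j with rfl | hij
  · rw [diag, one_apply_eq]
  · have h1 := hsphere ((3 / 5 : ℝ) • Pi.single i 1 + (4 / 5 : ℝ) • Pi.single j 1) (by
      simp [hij, hij.symm]
      norm_num)
    simp only [mulVec_add, mulVec_smul, add_dotProduct, dotProduct_add, smul_dotProduct,
      dotProduct_smul, diag, smul_eq_mul,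
      dotProduct_comm (A *ᵥ Pi.single j 1) (A *ᵥ Pi.single i 1)] at h1
    rw [one_apply_ne hij]
    linarith

/-- Diagonal matrices with the same characteristic polynomial are conjugate by a permutation. -/
lemma exists_perm_of_charpoly_diagonal_eq {R : Type*} [CommRing R] [IsDomain R] {f g : n → R}
    (hfg : (diagonal f).charpoly = (diagonal g).charpoly) :
    ∃ σ : Equiv.Perm n, diagonal f =
      (σ.toPEquiv.toMatrix : Matrix n n R) * diagonal g * (σ.toPEquiv.toMatrix)ᵀ := by
  have hroots (f : n → R) : (diagonal f).charpoly.roots = Finset.univ.val.map f := by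
    rw [charpoly_diagonal, Finset.prod, ← Polynomial.roots_multiset_prod_X_sub_C
      (Finset.univ.val.map f), Multiset.map_map]
    rfl
  obtain ⟨σ, hσ⟩ := exists_perm_of_map_univ_eq ((hroots f).symm.trans
    ((congrArg Polynomial.roots hfg).trans (hroots g)))
  refine ⟨σ, ?_⟩
  rw [← PEquiv.toMatrix_symm, ← Equiv.toPEquiv_symm, PEquiv.toMatrix_toPEquiv_mul,
    PEquiv.mul_toMatrix_toPEquiv]
  ext i j
  simp [diagonal_apply, hσ]

end AnisotropicIdentifiability

open AnisotropicIdentifiability in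
/-- (Deterministic core of the identifiability theorem for
anisotropic contrastive learning.) Let `d ≥ 2`, let `Λ, Λ̂` be positive
definite diagonal `d × d` real matrices, let `h` map the unit hypersphere
`S^{d-1} = {z : z ⬝ᵥ z = 1}` to itself, and let `c : S^{d-1} → ℝ` be such that
`(h z̃ - h z)ᵀ Λ̂ (h z̃ - h z) = c z + (z̃ - z)ᵀ Λ (z̃ - z)` for all `z, z̃` on
the sphere.  Then `c ≡ 0` on the sphere, `h` is the restriction of an
orthogonal matrix `H`, and there is a permutation matrix `P` with
`Λ̂ = P * Λ * Pᵀ` such that the orthogonal matrix `Pᵀ * H` commutes with `Λ`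
(hence is block-diagonal, each orthogonal block acting on the coordinates
sharing a common diagonal entry of `Λ`). -/
theorem anisotropic_functional_equation_identifiability
    (d : ℕ) (hd : 2 ≤ d)
    (Λ Λhat : Matrix (Fin d) (Fin d) ℝ)
    (hΛdiag : Λ.IsDiag) (hΛhatdiag : Λhat.IsDiag)
    (hΛpd : Λ.PosDef) (hΛhatpd : Λhat.PosDef)
    (h : (Fin d → ℝ) → (Fin d → ℝ))
    (hsphere : ∀ z : Fin d → ℝ, z ⬝ᵥ z = 1 → (h z) ⬝ᵥ (h z) = 1)
    (c : (Fin d → ℝ) → ℝ)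
    (heq : ∀ z zt : Fin d → ℝ, z ⬝ᵥ z = 1 → zt ⬝ᵥ zt = 1 →
      (h zt - h z) ⬝ᵥ Λhat.mulVec (h zt - h z) =
        c z + (zt - z) ⬝ᵥ Λ.mulVec (zt - z)) :
    (∀ z : Fin d → ℝ, z ⬝ᵥ z = 1 → c z = 0) ∧
    ∃ H : Matrix (Fin d) (Fin d) ℝ,
      Hᵀ * H = 1 ∧
      (∀ z : Fin d → ℝ, z ⬝ᵥ z = 1 → h z = H.mulVec z) ∧
      ∃ σ : Equiv.Perm (Fin d),
        Λhat = (σ.toPEquiv.toMatrix : Matrix (Fin d) (Fin d) ℝ) * Λ *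
          (σ.toPEquiv.toMatrix : Matrix (Fin d) (Fin d) ℝ)ᵀ ∧
        ((σ.toPEquiv.toMatrix : Matrix (Fin d) (Fin d) ℝ)ᵀ * H) * Λ =
          Λ * ((σ.toPEquiv.toMatrix : Matrix (Fin d) (Fin d) ℝ)ᵀ * H) ∧
        (∀ i j : Fin d, Λ i i ≠ Λ j j →
          ((σ.toPEquiv.toMatrix : Matrix (Fin d) (Fin d) ℝ)ᵀ * H) i j = 0) := by
  have hc : ∀ z : Fin d → ℝ, z ⬝ᵥ z = 1 → c z = 0 := by
    intro z hz
    simpa using (heq z z hz hz).symm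
  refine ⟨hc, ?_⟩
  have : Nonempty (Fin d) := ⟨⟨0, by omega⟩⟩
  obtain ⟨H, b, hHΛ, hH⟩ := exists_affine_of_quadraticForm_sub_eq (M := Λhat) (N := Λ)
    hΛhatdiag.isSymm hΛdiag.isSymm hΛpd.isUnit (h := h) fun z hz w hw => by
      rw [heq z w hz hw, hc z hz, zero_add]
  have hHu : IsUnit H := by
    have hu := hΛpd.isUnit
    rw [isUnit_iff_isUnit_det] at hu ⊢
    rw [← hHΛ, det_mul] at hu
    exact isUnit_of_mul_isUnit_right hu
  obtain ⟨hHH, rfl⟩ := orthogonal_of_affine_maps_sphere hHu fun z hz => by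
    rw [← hH z hz]
    exact hsphere z hz
  have hHH' : H * Hᵀ = 1 := mul_eq_one_comm.1 hHH
  have hcharpoly : Λhat.charpoly = Λ.charpoly := by
    rw [← hHΛ, charpoly_mul_comm, ← Matrix.mul_assoc, hHH', Matrix.one_mul]
  rw [← hΛdiag.diagonal_diag, ← hΛhatdiag.diagonal_diag] at hcharpoly
  obtain ⟨σ, hσ⟩ := exists_perm_of_charpoly_diagonal_eq hcharpoly
  rw [hΛdiag.diagonal_diag, hΛhatdiag.diagonal_diag] at hσ
  refine ⟨H, hHH, fun z hz => by rw [hH z hz, add_zero], σ, hσ, ?_⟩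
  set P : Matrix (Fin d) (Fin d) ℝ := σ.toPEquiv.toMatrix
  have hPP : Pᵀ * P = 1 := by
    rw [← PEquiv.toMatrix_symm, ← PEquiv.toMatrix_trans, ← Equiv.toPEquiv_symm,
      ← Equiv.toPEquiv_trans]
    simp
  have hcomm : Pᵀ * H * Λ = Λ * (Pᵀ * H) := calc
    Pᵀ * H * Λ = Pᵀ * (H * Hᵀ) * Λhat * H := by simp only [← hHΛ, Matrix.mul_assoc]
    _ = (Pᵀ * P) * Λ * Pᵀ * H := by rw [hHH', hσ]; simp only [Matrix.mul_assoc, Matrix.one_mul]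
    _ = Λ * (Pᵀ * H) := by rw [hPP, Matrix.one_mul, Matrix.mul_assoc]
  refine ⟨hcomm, fun i j hij => ?_⟩
  have hentry := congrFun (congrFun hcomm i) j
  rw [← hΛdiag.diagonal_diag, mul_diagonal, diagonal_mul, diag_apply, diag_apply] at hentry
  by_contra hne
  exact hij (mul_right_cancel₀ hne (by rw [← hentry, mul_comm]))
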